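/- The axiomatization RML is sound for refinement modal logic: every formula φ of L_∀ derivable in RML is valid, i.e. ⊢ φ implies ⊨ φ. -/

import Mathlib

/-- A Kripke model over agents `A` and propositional variables `P`. -/
structure KModel (A P : Type) where
  S : Type
  R : A → S → S → Prop
  V : P → S → Prop

/-- `Refines B M s N t`: there is a `B`-refinement from `M_s` to `N_t`. -/
def Refines {A P : Type} (B : Set A) (M : KModel A P) (s : M.S)
    (N : KModel A P) (t : N.S) : Prop :=
  ∃ Z : M.S → N.S → Prop,
    Z s t ∧
    (∀ u v, Z u v → ∀ p, M.V p u ↔ N.V p v) ∧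
    (∀ a : A, ∀ u v, Z u v → ∀ v', N.R a v v' → ∃ u', M.R a u u' ∧ Z u' v') ∧
    (∀ a : A, a ∉ B → ∀ u v, Z u v → ∀ u', M.R a u u' → ∃ v', N.R a v v' ∧ Z u' v')

/-- The language `L_∀` of refinement modal logic. -/
inductive RForm (A P : Type) : Type where
  | atom : P → RForm A P
  | neg : RForm A P → RForm A P
  | and : RForm A P → RForm A P → RForm A P
  | box : A → RForm A P → RForm A P
  | rall : A → RForm A P → RForm A P

/-- Satisfaction for refinement modal logic. -/
def Sat {A P : Type} : (M : KModel A P) → M.S → RForm A P → Prop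
  | M, s, .atom p => M.V p s
  | M, s, .neg φ => ¬ Sat M s φ
  | M, s, .and φ ψ => Sat M s φ ∧ Sat M s ψ
  | M, s, .box a φ => ∀ t, M.R a s t → Sat M t φ
  | M, s, .rall a φ => ∀ (N : KModel A P) (t : N.S), Refines {a} M s N t → Sat N t φ

/-- Material implication `φ → ψ`, as an abbreviation. -/
def fimp {A P : Type} (φ ψ : RForm A P) : RForm A P := .neg (.and φ (.neg ψ))

/-- Biimplication `φ ↔ ψ`, as an abbreviation. -/
def fiff {A P : Type} (φ ψ : RForm A P) : RForm A P := .and (fimp φ ψ) (fimp ψ φ)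

/-- `◇_a φ := ¬□_a ¬φ`. -/
def fdia {A P : Type} (a : A) (φ : RForm A P) : RForm A P := .neg (.box a (.neg φ))

/-- `∃_a φ := ¬∀_a ¬φ`. -/
def fex {A P : Type} (a : A) (φ : RForm A P) : RForm A P := .neg (.rall a (.neg φ))

/-- A formula is valid iff it is true at every pointed model. -/
def Valid {A P : Type} (φ : RForm A P) : Prop :=
  ∀ (M : KModel A P) (s : M.S), Sat M s φ

/-- `⊥` (using a fixed propositional variable). -/
def fbot {A P : Type} [Inhabited P] : RForm A P :=
  .and (.atom default) (.neg (.atom default))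

/-- `⊤`. -/
def ftop {A P : Type} [Inhabited P] : RForm A P := .neg fbot

/-- Disjunction, as an abbreviation. -/
def forr {A P : Type} (φ ψ : RForm A P) : RForm A P := .neg (.and (.neg φ) (.neg ψ))

/-- Big disjunction `⋁ Φ` of a finite list of formulas (`⋁ ∅ = ⊥`). -/
def disjList {A P : Type} [Inhabited P] : List (RForm A P) → RForm A P
  | [] => fbot
  | [φ] => φ
  | φ :: ψ :: l => forr φ (disjList (ψ :: l))

/-- Big conjunction `⋀ Φ` of a finite list of formulas (`⋀ ∅ = ⊤`). -/
def conjList {A P : Type} [Inhabited P] : List (RForm A P) → RForm A P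
  | [] => ftop
  | [φ] => φ
  | φ :: ψ :: l => .and φ (conjList (ψ :: l))

/-- The cover operator `∇_a Φ := □_a ⋁ Φ ∧ ⋀_{φ ∈ Φ} ◇_a φ`. -/
def cover {A P : Type} [Inhabited P] (a : A) (l : List (RForm A P)) : RForm A P :=
  .and (.box a (disjList l)) (conjList (l.map (fdia a)))

/-- Propositional evaluation treating atoms, boxes and refinement quantifiers as
propositional atoms. -/
def pEval {A P : Type} (v : RForm A P → Prop) : RForm A P → Prop
  | .neg φ => ¬ pEval v φ
  | .and φ ψ => pEval v φ ∧ pEval v ψ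
  | .atom p => v (.atom p)
  | .box a φ => v (.box a φ)
  | .rall a φ => v (.rall a φ)

/-- `φ` is a substitution instance of a propositional tautology. -/
def Taut {A P : Type} (φ : RForm A P) : Prop := ∀ v, pEval v φ

/-- Derivability in the axiomatization **RML**. -/
inductive Deriv {A P : Type} [Inhabited P] : RForm A P → Prop where
  /-- **Prop**: all (substitution instances of) propositional tautologies. -/
  | prop {φ} : Taut φ → Deriv φ
  /-- **K**. -/
  | axK (a : A) (φ ψ : RForm A P) :
      Deriv (fimp (.box a (fimp φ ψ)) (fimp (.box a φ) (.box a ψ)))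
  /-- **R**. -/
  | axR (a : A) (φ ψ : RForm A P) :
      Deriv (fimp (.rall a (fimp φ ψ)) (fimp (.rall a φ) (.rall a ψ)))
  /-- **RProp**, positive half. -/
  | axRProp1 (a : A) (p : P) : Deriv (fiff (.rall a (.atom p)) (.atom p))
  /-- **RProp**, negative half. -/
  | axRProp2 (a : A) (p : P) :
      Deriv (fiff (.rall a (.neg (.atom p))) (.neg (.atom p)))
  /-- **RK**: `∃_a ∇_a Φ ↔ ⋀_{φ∈Φ} ◇_a ∃_a φ`. -/
  | axRK (a : A) (Φ : List (RForm A P)) :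
      Deriv (fiff (fex a (cover a Φ))
        (conjList (Φ.map (fun φ => fdia a (fex a φ)))))
  /-- **RKmulti**: `∃_a ∇_b Φ ↔ ∇_b (∃_a Φ)` for `b ≠ a`. -/
  | axRKmulti (a b : A) (hba : b ≠ a) (Φ : List (RForm A P)) :
      Deriv (fiff (fex a (cover b Φ)) (cover b (Φ.map (fex a))))
  /-- **RKconj**: `∃_a ⋀_{b∈B} ∇_b Φᵇ ↔ ⋀_{b∈B} ∃_a ∇_b Φᵇ` for `B ⊆ A`. -/
  | axRKconj (a : A) (L : List (A × List (RForm A P)))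
      (hB : (L.map Prod.fst).Nodup) :
      Deriv (fiff (fex a (conjList (L.map (fun bl => cover bl.1 bl.2))))
        (conjList (L.map (fun bl => fex a (cover bl.1 bl.2)))))
  /-- **MP**. -/
  | mp {φ ψ} : Deriv (fimp φ ψ) → Deriv φ → Deriv ψ
  /-- **NecK**. -/
  | necK (a : A) {φ} : Deriv φ → Deriv (.box a φ)
  /-- **NecR**. -/
  | necR (a : A) {φ} : Deriv φ → Deriv (.rall a φ)

namespace Refines

variable {A P : Type} {B : Set A} {M N K : KModel A P}

theorem refl (M : KModel A P) (B : Set A) (s : M.S) : Refines B M s M s :=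
  ⟨Eq, rfl, by rintro u _ rfl p; rfl, by rintro a u _ rfl v hv; exact ⟨v, hv, rfl⟩,
    by rintro a _ u _ rfl v hv; exact ⟨v, hv, rfl⟩⟩

theorem atoms {s : M.S} {t : N.S} (h : Refines B M s N t) (p : P) : M.V p s ↔ N.V p t := by
  obtain ⟨Z, hst, hatoms, -, -⟩ := h
  exact hatoms s t hst p

theorem back {s : M.S} {t : N.S} (h : Refines B M s N t) {a : A} {v : N.S} (hv : N.R a t v) :
    ∃ u, M.R a s u ∧ Refines B M u N v := by
  obtain ⟨Z, hst, hatoms, hback, hforth⟩ := h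
  obtain ⟨u, hu, huv⟩ := hback a s t hst v hv
  exact ⟨u, hu, Z, huv, hatoms, hback, hforth⟩

theorem forth {s : M.S} {t : N.S} (h : Refines B M s N t) {a : A} (ha : a ∉ B) {u : M.S}
    (hu : M.R a s u) : ∃ v, N.R a t v ∧ Refines B M u N v := by
  obtain ⟨Z, hst, hatoms, hback, hforth⟩ := h
  obtain ⟨v, hv, huv⟩ := hforth a ha s t hst u hu
  exact ⟨v, hv, Z, huv, hatoms, hback, hforth⟩

theorem mono {C : Set A} (hBC : B ⊆ C) {s : M.S} {t : N.S} (h : Refines B M s N t) :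
    Refines C M s N t := by
  obtain ⟨Z, hst, hatoms, hback, hforth⟩ := h
  exact ⟨Z, hst, hatoms, hback, fun a ha => hforth a fun hB => ha (hBC hB)⟩

theorem trans {s : M.S} {t : N.S} {r : K.S} (h₁ : Refines B M s N t) (h₂ : Refines B N t K r) :
    Refines B M s K r := by
  refine ⟨fun u w => ∃ v, Refines B M u N v ∧ Refines B N v K w, ⟨t, h₁, h₂⟩, ?_, ?_, ?_⟩
  · rintro u w ⟨v, huv, hvw⟩ p
    exact (huv.atoms p).trans (hvw.atoms p)
  · rintro a u w ⟨v, huv, hvw⟩ w' hw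
    obtain ⟨v', hv, hvw'⟩ := hvw.back hw
    obtain ⟨u', hu, huv'⟩ := huv.back hv
    exact ⟨u', hu, v', huv', hvw'⟩
  · rintro a ha u w ⟨v, huv, hvw⟩ u' hu
    obtain ⟨v', hv, huv'⟩ := huv.forth ha hu
    obtain ⟨w', hw, hvw'⟩ := hvw.forth ha hv
    exact ⟨w', hw, v', huv', hvw'⟩

/-- Refinements in which every agent satisfies forth are bisimulations, hence symmetric. -/
theorem symm {s : M.S} {t : N.S} (h : Refines ∅ M s N t) : Refines ∅ N t M s :=
  ⟨fun v u => Refines ∅ M u N v, h, fun _ _ huv p => (huv.atoms p).symm,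
    fun a _ _ huv _ hu => huv.forth (Set.notMem_empty a) hu,
    fun _ _ _ _ huv _ hv => huv.back hv⟩

end Refines

section Semantics

variable {A P : Type} {M : KModel A P}

/-- Satisfaction is invariant under bisimulation. -/
theorem Refines.sat_iff (φ : RForm A P) :
    ∀ {M N : KModel A P} {s : M.S} {t : N.S}, Refines ∅ M s N t → (Sat M s φ ↔ Sat N t φ) := by
  induction φ with
  | atom p => intro M N s t h; exact h.atoms p
  | neg φ ih => intro M N s t h; exact not_congr (ih h)
  | and φ ψ ihφ ihψ => intro M N s t h; exact and_congr (ihφ h) (ihψ h)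
  | box a φ ih =>
    intro M N s t h
    constructor
    · intro hs v hv
      obtain ⟨u, hu, huv⟩ := h.back hv
      exact (ih huv).1 (hs u hu)
    · intro ht u hu
      obtain ⟨v, hv, huv⟩ := h.forth (Set.notMem_empty a) hu
      exact (ih huv).2 (ht v hv)
  | rall a φ ih =>
    intro M N s t h
    exact ⟨fun hs K r hr => hs K r ((h.mono (Set.empty_subset _)).trans hr),
      fun ht K r hr => ht K r ((h.symm.mono (Set.empty_subset _)).trans hr)⟩

theorem sat_fimp {s : M.S} {φ ψ : RForm A P} :
    Sat M s (fimp φ ψ) ↔ (Sat M s φ → Sat M s ψ) := by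
  simp [fimp, Sat]

theorem sat_fiff {s : M.S} {φ ψ : RForm A P} :
    Sat M s (fiff φ ψ) ↔ (Sat M s φ ↔ Sat M s ψ) := by
  rw [iff_iff_implies_and_implies (a := Sat M s φ), ← sat_fimp, ← sat_fimp]
  rfl

theorem sat_fdia {s : M.S} {a : A} {φ : RForm A P} :
    Sat M s (fdia a φ) ↔ ∃ u, M.R a s u ∧ Sat M u φ := by
  simp [fdia, Sat]

theorem sat_fex {s : M.S} {a : A} {φ : RForm A P} :
    Sat M s (fex a φ) ↔ ∃ (N : KModel A P) (t : N.S), Refines {a} M s N t ∧ Sat N t φ := by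
  simp [fex, Sat]

theorem sat_iff_pEval {s : M.S} (φ : RForm A P) : Sat M s φ ↔ pEval (Sat M s) φ := by
  induction φ with
  | neg φ ih => exact not_congr ih
  | and φ ψ ihφ ihψ => exact and_congr ihφ ihψ
  | _ => rfl

variable [Inhabited P]

theorem sat_disjList {s : M.S} (l : List (RForm A P)) :
    Sat M s (disjList l) ↔ ∃ φ ∈ l, Sat M s φ := by
  induction l with
  | nil => simp [disjList, fbot, Sat]
  | cons φ l ih =>
    cases l with
    | nil => simp [disjList]
    | cons ψ l =>
      have h : Sat M s (disjList (φ :: ψ :: l)) ↔ Sat M s φ ∨ Sat M s (disjList (ψ :: l)) := by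
        simp [disjList, forr, Sat, or_iff_not_imp_left]
      rw [h, ih]
      simp

theorem sat_conjList {s : M.S} (l : List (RForm A P)) :
    Sat M s (conjList l) ↔ ∀ φ ∈ l, Sat M s φ := by
  induction l with
  | nil => simp [conjList, ftop, fbot, Sat]
  | cons φ l ih =>
    cases l with
    | nil => simp [conjList]
    | cons ψ l =>
      rw [List.forall_mem_cons, ← ih]
      rfl

theorem sat_cover {s : M.S} {a : A} {l : List (RForm A P)} :
    Sat M s (cover a l) ↔ (∀ u, M.R a s u → ∃ φ ∈ l, Sat M u φ) ∧
      ∀ φ ∈ l, ∃ u, M.R a s u ∧ Sat M u φ := by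
  simp [cover, Sat, sat_conjList, sat_disjList, sat_fdia]

end Semantics

section Grafting

variable {A P : Type}

/-- A new root, with the atoms of `M_s`, whose `b`-successors are the points `pt b i` of the
models `K b i`. -/
def graft (M : KModel A P) (s : M.S) {I : A → Type} (K : ∀ b, I b → KModel A P)
    (pt : ∀ b i, (K b i).S) : KModel A P where
  S := Option (Σ b, Σ i : I b, (K b i).S)
  R c x y := match x, y with
    | _, none => False
    | none, some ⟨b, i, w⟩ => b = c ∧ w = pt b i
    | some ⟨b, i, v⟩, some y => ∃ w, y = ⟨b, i, w⟩ ∧ (K b i).R c v w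
  V p x := match x with
    | none => M.V p s
    | some ⟨b, i, v⟩ => (K b i).V p v

/-- `(K i, pt i)` is a legitimate family of `b`-successors for the root of an `a`-refinement
of `M_s`. -/
def SuccFamily (M : KModel A P) (s : M.S) (a b : A) {I : Type} (K : I → KModel A P)
    (pt : ∀ i, (K i).S) : Prop :=
  (∀ i, ∃ u, M.R b s u ∧ Refines {a} M u (K i) (pt i)) ∧
    (b ≠ a → ∀ u, M.R b s u → ∃ i, Refines {a} M u (K i) (pt i))

theorem succFamily_of_refines {M N : KModel A P} {s : M.S} {t : N.S} {a : A}
    (h : Refines {a} M s N t) (b : A) :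
    SuccFamily M s a b (fun _ : {v // N.R b t v} => N) Subtype.val := by
  refine ⟨fun i => h.back i.2, fun hb u hu => ?_⟩
  obtain ⟨v, hv, huv⟩ := h.forth (by simpa using hb) hu
  exact ⟨⟨v, hv⟩, huv⟩

variable {M : KModel A P} {s : M.S} {a : A} {I : A → Type} {K : ∀ b, I b → KModel A P}
  {pt : ∀ b i, (K b i).S}

theorem refines_graft_some (b : A) (i : I b) (w : (K b i).S) :
    Refines ∅ (K b i) w (graft M s K pt) (some ⟨b, i, w⟩) := by
  refine ⟨fun v x => x = some ⟨b, i, v⟩, rfl, ?_, ?_, ?_⟩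
  · rintro v _ rfl p
    rfl
  · rintro c v _ rfl (_ | y) hy
    · exact hy.elim
    · obtain ⟨w, hy, hw⟩ := hy
      exact ⟨w, hw, congrArg some hy⟩
  · rintro c - v _ rfl v' hv
    exact ⟨some ⟨b, i, v'⟩, ⟨v', rfl, hv⟩, rfl⟩

theorem refines_graft_none (h : ∀ b, SuccFamily M s a b (K b) (pt b)) :
    Refines {a} M s (graft M s K pt) none := by
  have lift {u : M.S} {b : A} {i : I b} {w : (K b i).S} (hw : Refines {a} M u (K b i) w) :
      Refines {a} M u (graft M s K pt) (some ⟨b, i, w⟩) :=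
    hw.trans ((refines_graft_some b i w).mono (Set.empty_subset _))
  refine ⟨fun u x => (u = s ∧ x = none) ∨ Refines {a} M u (graft M s K pt) x,
    Or.inl ⟨rfl, rfl⟩, ?_, ?_, ?_⟩
  · rintro u x (⟨rfl, rfl⟩ | hux) p
    · rfl
    · exact hux.atoms p
  · rintro c u x (⟨rfl, rfl⟩ | hux) y hy
    · match y, hy with
      | some ⟨b, i, w⟩, ⟨hb, hw⟩ =>
        subst hb hw
        obtain ⟨u', hu', hr⟩ := (h b).1 i
        exact ⟨u', hu', Or.inr (lift hr)⟩
    · obtain ⟨u', hu', hr⟩ := hux.back hy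
      exact ⟨u', hu', Or.inr hr⟩
  · rintro c hc u x (⟨rfl, rfl⟩ | hux) u' hu'
    · obtain ⟨i, hi⟩ := (h c).2 hc u' hu'
      exact ⟨some ⟨c, i, pt c i⟩, ⟨rfl, rfl⟩, Or.inr (lift hi)⟩
    · obtain ⟨y, hy, hr⟩ := hux.forth hc hu'
      exact ⟨y, hy, Or.inr hr⟩

theorem sat_cover_graft [Inhabited P] {b : A} {Φ : List (RForm A P)}
    (h₁ : ∀ i, ∃ φ ∈ Φ, Sat (K b i) (pt b i) φ)
    (h₂ : ∀ φ ∈ Φ, ∃ i, Sat (K b i) (pt b i) φ) :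
    Sat (graft M s K pt) none (cover b Φ) := by
  refine sat_cover.2 ⟨?_, fun φ hφ => ?_⟩
  · intro y hy
    match y, hy with
    | some ⟨c, i, w⟩, ⟨hc, hw⟩ =>
      subst hc hw
      obtain ⟨φ, hφ, hi⟩ := h₁ i
      exact ⟨φ, hφ, ((refines_graft_some _ i _).sat_iff φ).1 hi⟩
  · obtain ⟨i, hi⟩ := h₂ φ hφ
    exact ⟨some ⟨b, i, pt b i⟩, ⟨rfl, rfl⟩, ((refines_graft_some b i _).sat_iff φ).1 hi⟩

/-- Cover formulas for distinct agents can be realized simultaneously in one refinement. -/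
theorem exists_refines_sat_cover [Inhabited P] (Q : A → List (RForm A P) → Prop)
    (h : ∀ b, ∃ (J : Type) (K : J → KModel A P) (pt : ∀ i, (K i).S), SuccFamily M s a b K pt ∧
      ∀ Φ, Q b Φ → (∀ i, ∃ φ ∈ Φ, Sat (K i) (pt i) φ) ∧ ∀ φ ∈ Φ, ∃ i, Sat (K i) (pt i) φ) :
    ∃ (N : KModel A P) (t : N.S), Refines {a} M s N t ∧ ∀ b Φ, Q b Φ → Sat N t (cover b Φ) := by
  choose J K pt hfam hQ using h
  exact ⟨graft M s K pt, none, refines_graft_none hfam, fun b Φ hb =>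
    sat_cover_graft (hQ b Φ hb).1 (hQ b Φ hb).2⟩

/-- A single cover formula can be realized by prescribing the successors of one agent. -/
theorem sat_fex_cover [Inhabited P] {b : A} {Φ : List (RForm A P)} {J : Type}
    {K : J → KModel A P} {pt : ∀ i, (K i).S} (hfam : SuccFamily M s a b K pt)
    (h₁ : ∀ i, ∃ φ ∈ Φ, Sat (K i) (pt i) φ) (h₂ : ∀ φ ∈ Φ, ∃ i, Sat (K i) (pt i) φ) :
    Sat M s (fex a (cover b Φ)) := by
  obtain ⟨N, t, hr, hN⟩ := exists_refines_sat_cover (M := M) (s := s) (a := a)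
    (fun c Ψ => c = b ∧ Ψ = Φ) fun c => by
      by_cases hc : c = b
      · subst hc
        exact ⟨J, K, pt, hfam, by rintro _ ⟨-, rfl⟩; exact ⟨h₁, h₂⟩⟩
      · exact ⟨_, _, _, succFamily_of_refines (Refines.refl M {a} s) c,
          fun Ψ hΨ => (hc hΨ.1).elim⟩
  exact sat_fex.2 ⟨N, t, hr, hN b Φ ⟨rfl, rfl⟩⟩

end Grafting

section Axioms

variable {A P : Type} [Inhabited P]

theorem valid_RK (a : A) (Φ : List (RForm A P)) :
    Valid (fiff (fex a (cover a Φ)) (conjList (Φ.map fun φ => fdia a (fex a φ)))) := by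
  intro M s
  rw [sat_fiff, sat_conjList, List.forall_mem_map]
  constructor
  · intro h φ hφ
    obtain ⟨N, t, hr, hN⟩ := sat_fex.1 h
    obtain ⟨v, hv, hvφ⟩ := (sat_cover.1 hN).2 φ hφ
    obtain ⟨u, hu, huv⟩ := hr.back hv
    exact sat_fdia.2 ⟨u, hu, sat_fex.2 ⟨N, v, huv, hvφ⟩⟩
  · intro h
    simp only [sat_fdia, sat_fex] at h
    choose u hu N t hr hN using h
    exact sat_fex_cover (J := {φ // φ ∈ Φ}) (K := fun i => N i.1 i.2) (pt := fun i => t i.1 i.2)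
      ⟨fun i => ⟨u i.1 i.2, hu i.1 i.2, hr i.1 i.2⟩, fun hne => (hne rfl).elim⟩
      (fun i => ⟨i.1, i.2, hN i.1 i.2⟩) (fun φ hφ => ⟨⟨φ, hφ⟩, hN φ hφ⟩)

theorem valid_RKmulti (a b : A) (hba : b ≠ a) (Φ : List (RForm A P)) :
    Valid (fiff (fex a (cover b Φ)) (cover b (Φ.map (fex a)))) := by
  intro M s
  rw [sat_fiff, sat_cover, List.forall_mem_map]
  simp only [List.mem_map, exists_exists_and_eq_and]
  constructor
  · intro h
    obtain ⟨N, t, hr, hN⟩ := sat_fex.1 h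
    rw [sat_cover] at hN
    constructor
    · intro u hu
      obtain ⟨v, hv, huv⟩ := hr.forth (by simpa using hba) hu
      obtain ⟨φ, hφ, hvφ⟩ := hN.1 v hv
      exact ⟨φ, hφ, sat_fex.2 ⟨N, v, huv, hvφ⟩⟩
    · intro φ hφ
      obtain ⟨v, hv, hvφ⟩ := hN.2 φ hφ
      obtain ⟨u, hu, huv⟩ := hr.back hv
      exact ⟨u, hu, sat_fex.2 ⟨N, v, huv, hvφ⟩⟩
  · rintro ⟨h₁, h₂⟩
    let J := {x : M.S × RForm A P // M.R b s x.1 ∧ x.2 ∈ Φ ∧ Sat M x.1 (fex a x.2)}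
    have hJ (i : J) : ∃ (N : KModel A P) (t : N.S), Refines {a} M i.1.1 N t ∧ Sat N t i.1.2 :=
      sat_fex.1 i.2.2.2
    choose N t hr hN using hJ
    refine sat_fex_cover (K := N) (pt := t)
      ⟨fun i => ⟨i.1.1, i.2.1, hr i⟩, fun _ u hu => ?_⟩
      (fun i => ⟨i.1.2, i.2.2.1, hN i⟩) (fun φ hφ => ?_)
    · obtain ⟨φ, hφ, huφ⟩ := h₁ u hu
      exact ⟨⟨(u, φ), hu, hφ, huφ⟩, hr _⟩
    · obtain ⟨u, hu, huφ⟩ := h₂ φ hφ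
      exact ⟨⟨(u, φ), hu, hφ, huφ⟩, hN ⟨(u, φ), hu, hφ, huφ⟩⟩

theorem valid_RKconj (a : A) (L : List (A × List (RForm A P))) (hL : (L.map Prod.fst).Nodup) :
    Valid (fiff (fex a (conjList (L.map fun bl => cover bl.1 bl.2)))
      (conjList (L.map fun bl => fex a (cover bl.1 bl.2)))) := by
  intro M s
  simp only [sat_fiff, sat_fex, sat_conjList, List.forall_mem_map]
  constructor
  · rintro ⟨N, t, hr, hN⟩ bl hbl
    exact ⟨N, t, hr, hN bl hbl⟩
  · intro h
    obtain ⟨N, t, hr, hN⟩ := exists_refines_sat_cover (M := M) (s := s) (a := a)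
      (fun b Φ => (b, Φ) ∈ L) fun b => by
        by_cases hb : ∃ Φ, (b, Φ) ∈ L
        · obtain ⟨Φ, hΦ⟩ := hb
          obtain ⟨N, t, hr, hN⟩ := h _ hΦ
          refine ⟨_, _, _, succFamily_of_refines hr b, fun Ψ hΨ => ?_⟩
          obtain rfl : Φ = Ψ :=
            congrArg Prod.snd (List.inj_on_of_nodup_map hL hΦ hΨ rfl)
          rw [sat_cover] at hN
          refine ⟨fun i => hN.1 i.1 i.2, fun φ hφ => ?_⟩
          obtain ⟨v, hv, hvφ⟩ := hN.2 φ hφ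
          exact ⟨⟨v, hv⟩, hvφ⟩
        · exact ⟨_, _, _, succFamily_of_refines (Refines.refl M {a} s) b,
            fun Φ hΦ => (hb ⟨Φ, hΦ⟩).elim⟩
    exact ⟨N, t, hr, fun bl hbl => hN bl.1 bl.2 hbl⟩

end Axioms

/-- Soundness of **RML**: every derivable formula of `L_∀` is valid. -/
theorem RML_sound {A P : Type} [Inhabited P] (φ : RForm A P) :
    Deriv φ → Valid φ := by
  intro h
  induction h with
  | prop h => exact fun M s => (sat_iff_pEval _).2 (h _)
  | axK a φ ψ =>
    intro M s
    simp only [sat_fimp, Sat]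
    exact fun h₁ h₂ t ht => h₁ t ht (h₂ t ht)
  | axR a φ ψ =>
    intro M s
    simp only [sat_fimp, Sat]
    exact fun h₁ h₂ N t ht => h₁ N t ht (h₂ N t ht)
  | axRProp1 a p =>
    intro M s
    rw [sat_fiff]
    exact ⟨fun h => h M s (Refines.refl M _ s), fun h N t hr => (hr.atoms p).1 h⟩
  | axRProp2 a p =>
    intro M s
    rw [sat_fiff]
    exact ⟨fun h => h M s (Refines.refl M _ s), fun h N t hr => fun ht => h ((hr.atoms p).2 ht)⟩
  | axRK a Φ => exact valid_RK a Φ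
  | axRKmulti a b hba Φ => exact valid_RKmulti a b hba Φ
  | axRKconj a L hL => exact valid_RKconj a L hL
  | mp _ _ ih₁ ih₂ => exact fun M s => sat_fimp.1 (ih₁ M s) (ih₂ M s)
  | necK a _ ih => exact fun M s t _ => ih M t
  | necR a _ ih => exact fun M s N t _ => ih N t
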